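/- For any absolute constants A > 0, D ≥ 1, 𝖠 > 0, 𝖢 > 0, c₀ > 0, C₀ > 0 there exist constants c > 0, c₁ > 0, C > 0, d > 0 and W₀ such that the following holds for every integer W ≥ W₀ and all real coefficients 𝖺, 𝖻, 𝖼 with 𝖺² > 0. Let ℙ be the probability measure on (0,∞) with density μ r^{W−1} exp(−W(𝖺²r⁴ + 𝖻r² + 𝖼r)), μ the normalizing constant, and let r denote the identity random variable on ((0,∞), ℙ). Assume: (I) max(𝖺², |𝖻|, |𝖼|) ≤ 2A²W^{2D}; (II) ℙ{r ≥ A} ≤ C₀ e^{−c₀A²W}; (III) either max(𝖺², |𝖻|, |𝖼|) ≤ 𝖠, or there is a measurable set 𝓑_r ⊂ (0,∞) with ℙ(𝓑_r) ≤ C₀ e^{−c₀A²W} such that max(𝖺²r⁴, 𝖻r², |𝖼|r) ≤ 𝖠 for every r ∉ 𝓑_r, and furthermore either 𝖻 > 0 or |𝖻| < 𝖢^{−1}|𝖺|. Then Var(log r) ≥ c W^{−1}, and there exists a measurable set 𝓑_φ ⊂ (0,∞) with ℙ(𝓑_φ) ≤ C e^{−cW} such that r ≥ c₁ W^{−d}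 for every r ∈ (0,∞) ∖ 𝓑_φ. -/

import Mathlib

open MeasureTheory ProbabilityTheory

/-- The unnormalized super-exponential density `r^{W-1} exp(-W(𝖺²r⁴ + 𝖻r² + 𝖼r))`. -/
noncomputable def sDensity (W : ℕ) (a2 b c : ℝ) (r : ℝ) : ℝ :=
  r ^ (W - 1) * Real.exp (-(W : ℝ) * (a2 * r ^ 4 + b * r ^ 2 + c * r))

/-- The probability measure on `(0,∞)` with density proportional to
`r^{W-1} exp(-W(𝖺²r⁴ + 𝖻r² + 𝖼r))`. -/
noncomputable def sMeasure (W : ℕ) (a2 b c : ℝ) : Measure ℝ :=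
  (ENNReal.ofReal (∫ r in Set.Ioi (0 : ℝ), sDensity W a2 b c r))⁻¹ •
    ((volume.restrict (Set.Ioi (0 : ℝ))).withDensity
      fun r => ENNReal.ofReal (sDensity W a2 b c r))

lemma aux_sD_nonneg (W : ℕ) (a b c r : ℝ) (hr : 0 < r) : 0 ≤ sDensity W a b c r := by
  unfold sDensity; positivity

lemma aux_sD_pos (W : ℕ) (a b c r : ℝ) (hr : 0 < r) : 0 < sDensity W a b c r := by
  unfold sDensity; positivity

lemma aux_sD_cont (W : ℕ) (a b c : ℝ) : Continuous (sDensity W a b c) := by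
  unfold sDensity; fun_prop

lemma aux_poly (a b c : ℝ) (ha : 0 < a) : ∃ L : ℝ, ∀ r : ℝ, r - L ≤ a * r ^ 4 + b * r ^ 2 + c * r := by
  refine ⟨(c - 1) ^ 2 / 2 + (b - 1 / 2) ^ 2 / (4 * a), fun r => ?_⟩
  have h1 : 0 ≤ a * (r ^ 2 + (b - 1 / 2) / (2 * a)) ^ 2 := by positivity
  have h2 : a * (r ^ 2 + (b - 1 / 2) / (2 * a)) ^ 2
      = a * r ^ 4 + (b - 1 / 2) * r ^ 2 + (b - 1 / 2) ^ 2 / (4 * a) := by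
    field_simp
    ring
  nlinarith [sq_nonneg (r + (c - 1))]

lemma aux_int (n W : ℕ) (hW : 1 ≤ W) (a b c : ℝ) (ha : 0 < a) :
    IntegrableOn (fun r : ℝ => r ^ n * Real.exp (-(W : ℝ) * (a * r ^ 4 + b * r ^ 2 + c * r)))
      (Set.Ioi 0) := by
  have hW' : (0 : ℝ) < W := by exact_mod_cast hW
  obtain ⟨L, hL⟩ := aux_poly (W * a) (W * b) (W * c) (by positivity)
  have hG := Real.GammaIntegral_convergent (s := (n : ℝ) + 1) (by positivity)
  have hG2 : IntegrableOn (fun r : ℝ => Real.exp L * (Real.exp (-r) * r ^ ((n : ℝ) + 1 - 1)))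
    (Set.Ioi 0) := hG.const_mul _
  refine Integrable.mono' hG2 ?_ ?_
  · apply Continuous.aestronglyMeasurable
    fun_prop
  · filter_upwards [ae_restrict_mem measurableSet_Ioi] with r hr
    have hr : 0 < r := hr
    rw [Real.norm_of_nonneg (by positivity)]
    simp only [add_sub_cancel_right, Real.rpow_natCast]
    have : Real.exp (-(W : ℝ) * (a * r ^ 4 + b * r ^ 2 + c * r)) ≤ Real.exp L * Real.exp (-r) := by
      rw [← Real.exp_add]
      apply Real.exp_le_exp.mpr
      have := hL r
      linarith
    calc _ ≤ r ^ n * (Real.exp L * Real.exp (-r)) := by gcongr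
      _ = _ := by ring

lemma aux_Z_pos (W : ℕ) (hW : 1 ≤ W) (a b c : ℝ) (ha : 0 < a) :
    0 < ∫ r in Set.Ioi (0 : ℝ), sDensity W a b c r := by
  rw [setIntegral_pos_iff_support_of_nonneg_ae]
  · have : Function.support (sDensity W a b c) ∩ Set.Ioi 0 = Set.Ioi 0 := by
      apply Set.inter_eq_right.mpr
      intro r hr
      exact (aux_sD_pos W a b c r hr).ne'
    rw [this]
    simp
  · filter_upwards [ae_restrict_mem measurableSet_Ioi] with r hr
    exact aux_sD_nonneg W a b c r hr
  · exact aux_int (W - 1) W hW a b c ha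

lemma aux_prob (W : ℕ) (hW : 1 ≤ W) (a b c : ℝ) (ha : 0 < a) :
    IsProbabilityMeasure (sMeasure W a b c) := by
  constructor
  have h0 := aux_Z_pos W hW a b c ha
  unfold sMeasure
  rw [Measure.smul_apply, withDensity_apply _ MeasurableSet.univ, Measure.restrict_univ,
    ← ofReal_integral_eq_lintegral_ofReal (f := sDensity W a b c)
      (aux_int (W - 1) W hW a b c ha)]
  · rw [smul_eq_mul]
    apply ENNReal.inv_mul_cancel
    · simpa using h0
    · simp
  · filter_upwards [ae_restrict_mem measurableSet_Ioi] with r hr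
    exact aux_sD_nonneg W a b c r hr

lemma aux_ae (W : ℕ) (a b c : ℝ) : ∀ᵐ r ∂(sMeasure W a b c), 0 < r := by
  unfold sMeasure
  apply Measure.ae_smul_measure
  apply (withDensity_absolutelyContinuous _ _).ae_le
  exact ae_restrict_mem measurableSet_Ioi

lemma aux_memLp (W : ℕ) (hW : 3 ≤ W) (a b c : ℝ) (ha : 0 < a) :
    MemLp Real.log 2 (sMeasure W a b c) := by
  rw [memLp_two_iff_integrable_sq Real.measurable_log.aestronglyMeasurable]
  unfold sMeasure
  have h0 := aux_Z_pos W (by omega) a b c ha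
  apply Integrable.smul_measure
  swap
  · simpa using h0
  rw [integrable_withDensity_iff (by have := aux_sD_cont W a b c; fun_prop) (by simp)]
  have h1 := (aux_int (W + 1) W (by omega) a b c ha).const_mul 2
  have h2 := (aux_int (W - 3) W (by omega) a b c ha).const_mul 2
  refine Integrable.mono' (h1.add h2) ?_ ?_
  · have := (aux_sD_cont W a b c).measurable
    apply Measurable.aestronglyMeasurable
    fun_prop
  · filter_upwards [ae_restrict_mem measurableSet_Ioi] with r hr
    have hr : 0 < r := hr
    have hd := aux_sD_nonneg W a b c r hr
    rw [ENNReal.toReal_ofReal hd, Real.norm_of_nonneg (by positivity)]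
    have hl1 : Real.log r ≤ r := (Real.log_le_sub_one_of_pos hr).trans (by linarith)
    have hl2 : -Real.log r ≤ r⁻¹ := by
      rw [← Real.log_inv]
      exact (Real.log_le_sub_one_of_pos (inv_pos.mpr hr)).trans (by linarith)
    have hi : 0 < r⁻¹ := inv_pos.mpr hr
    have hsq : Real.log r ^ 2 ≤ 2 * r ^ 2 + 2 * (r⁻¹) ^ 2 := by
      rcases le_total 0 (Real.log r) with h | h
      · nlinarith
      · nlinarith
    obtain ⟨k, rfl⟩ : ∃ k, W = k + 3 := ⟨W - 3, by omega⟩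
    calc _ ≤ (2 * r ^ 2 + 2 * (r⁻¹) ^ 2) * sDensity (k + 3) a b c r := by gcongr
      _ = _ := by
        unfold sDensity
        simp only [Pi.add_apply, Nat.add_sub_cancel, show k + 3 - 1 = k + 2 by omega]
        field_simp
        ring

lemma aux_meas (W : ℕ) (a b c : ℝ) (S : Set ℝ) (hS : MeasurableSet S) (hS0 : S ⊆ Set.Ioi 0) :
    sMeasure W a b c S = (ENNReal.ofReal (∫ r in Set.Ioi (0 : ℝ), sDensity W a b c r))⁻¹ *
      ∫⁻ r in S, ENNReal.ofReal (sDensity W a b c r) := by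
  unfold sMeasure
  rw [Measure.smul_apply, withDensity_apply _ hS, Measure.restrict_restrict hS,
    Set.inter_eq_left.mpr hS0, smul_eq_mul]

lemma aux_scale (W : ℕ) (a b c : ℝ) (S : Set ℝ) (hS : MeasurableSet S) (hS0 : S ⊆ Set.Ioi 0)
    (l q : ℝ) (hl : 0 < l) (hq : 0 ≤ q)
    (h : ∀ r ∈ S, sDensity W a b c r ≤ q * (l * sDensity W a b c (l * r))) :
    sMeasure W a b c S ≤ ENNReal.ofReal q * sMeasure W a b c ((fun r => l * r) '' S) := by
  have hinj : Function.Injective (fun r : ℝ => l * r) := mul_right_injective₀ hl.ne'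
  have hm : MeasurableSet ((fun r => l * r) '' S) :=
    (measurableEmbedding_mulLeft₀ hl.ne').measurableSet_image.mpr hS
  rw [aux_meas W a b c S hS hS0, aux_meas W a b c _ hm, mul_left_comm]
  · gcongr
    rw [lintegral_image_eq_lintegral_abs_deriv_mul hS (f' := fun _ => l) _ hinj.injOn,
      ← lintegral_const_mul' _ _ (by simp)]
    · apply setLIntegral_mono' hS
      intro r hr
      rw [abs_of_pos hl, ← ENNReal.ofReal_mul hl.le, ← ENNReal.ofReal_mul hq]
      exact ENNReal.ofReal_le_ofReal (h r hr)
    · intro x _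
      simpa using ((hasDerivAt_id x).const_mul l).hasDerivWithinAt
  · rintro _ ⟨r, hr, rfl⟩
    exact mul_pos hl (hS0 hr)

/-- `r * density` -/
lemma aux_rsD (W : ℕ) (hW : 1 ≤ W) (a b c r : ℝ) :
    r * sDensity W a b c r = r ^ W * Real.exp (-(W : ℝ) * (a * r ^ 4 + b * r ^ 2 + c * r)) := by
  obtain ⟨k, rfl⟩ : ∃ k, W = k + 1 := ⟨W - 1, by omega⟩
  unfold sDensity
  simp only [Nat.add_sub_cancel]
  ring

lemma aux_small (W : ℕ) (hW : 1 ≤ W) (a b c M : ℝ) (hM : 1 ≤ M) (ha : 0 < a)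
    (haM : a ≤ M) (hb : |b| ≤ M) (hc : |c| ≤ M) :
    sMeasure W a b c (Set.Ioo 0 (Real.exp (-10) / M)) ≤ ENNReal.ofReal (Real.exp (-4 * W)) := by
  have := aux_prob W hW a b c ha
  have hb' := abs_le.mp hb
  have hc' := abs_le.mp hc
  refine (aux_scale W a b c _ measurableSet_Ioo (fun r hr => hr.1) (Real.exp 10)
    (Real.exp (-4 * W)) (Real.exp_pos _) (Real.exp_pos _).le ?_).trans ?_
  · intro r hr
    have hr0 : 0 < r := hr.1
    have key : ∀ x : ℝ, 0 < x → x * M ≤ 1 → |a * x ^ 4 + b * x ^ 2 + c * x| ≤ 3 := by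
      intro x hx hxM
      have hx1 : x ≤ 1 := by nlinarith
      have h2 : x ^ 2 ≤ x := by nlinarith
      have h4 : x ^ 4 ≤ x := by nlinarith [sq_nonneg (x ^ 2), pow_pos hx 2]
      have e1 : a * x ^ 4 ≤ 1 := by
        calc _ ≤ M * x := by gcongr
          _ ≤ 1 := by linarith
      have e2 : |b * x ^ 2| ≤ 1 := by
        rw [abs_mul, abs_of_pos (pow_pos hx 2)]
        calc _ ≤ M * x := by gcongr
          _ ≤ 1 := by linarith
      have e3 : |c * x| ≤ 1 := by
        rw [abs_mul, abs_of_pos hx]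
        calc _ ≤ M * x := by gcongr
          _ ≤ 1 := by linarith
      have e0 : 0 < a * x ^ 4 := by positivity
      rw [abs_le] at *
      constructor <;> linarith [e2.1, e2.2, e3.1, e3.2]
    have hMp : 0 < M := by linarith
    have hrM : r * M < Real.exp (-10) := (lt_div_iff₀ hMp).mp hr.2
    have k1 := abs_le.mp (key r hr0 (hrM.le.trans (Real.exp_le_one_iff.mpr (by norm_num))))
    have k2 := abs_le.mp (key (Real.exp 10 * r) (by positivity) (by
      have : Real.exp 10 * Real.exp (-10) = 1 := by rw [← Real.exp_add]; simp
      nlinarith [Real.exp_pos 10]))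
    refine le_of_mul_le_mul_left ?_ hr0
    have e : r * (Real.exp (-4 * W) * (Real.exp 10 * sDensity W a b c (Real.exp 10 * r)))
      = Real.exp (-4 * W) * ((Real.exp 10 * r) * sDensity W a b c (Real.exp 10 * r)) := by ring
    rw [e, aux_rsD W hW, aux_rsD W hW, mul_pow, ← Real.exp_nat_mul]
    set P := a * r ^ 4 + b * r ^ 2 + c * r
    set Q := a * (Real.exp 10 * r) ^ 4 + b * (Real.exp 10 * r) ^ 2 + c * (Real.exp 10 * r)
    have e' : Real.exp (-4 * W) * (Real.exp (W * 10) * r ^ W * Real.exp (-(W : ℝ) * Q))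
      = r ^ W * Real.exp (-4 * W + W * 10 + -(W : ℝ) * Q) := by
      rw [Real.exp_add, Real.exp_add]; ring
    rw [e']
    gcongr
    have hW0 : (0 : ℝ) ≤ W := by positivity
    nlinarith
  · calc _ ≤ ENNReal.ofReal (Real.exp (-4 * W)) * 1 := by gcongr; exact prob_le_one
      _ = _ := mul_one _

lemma aux_u (s : ℝ) (hs : 0 < s) (hs1 : s ≤ 1) :
    Real.exp s + Real.exp (-s) - 2 ≤ 9 * s ^ 2 := by
  have h1 : Real.exp s + Real.exp (-s) = 2 * Real.cosh s := by rw [Real.cosh_eq]; ring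
  have h2 := Real.cosh_le_exp_half_sq s
  have h3 : s ^ 2 / 2 ≤ 1 := by nlinarith
  have h4 := Real.abs_exp_sub_one_le (x := s ^ 2 / 2) (by rw [abs_of_nonneg (by positivity)]; exact h3)
  rw [abs_of_nonneg (a := s ^ 2 / 2) (by positivity)] at h4
  have h5 := (abs_le.mp h4).2
  nlinarith

lemma aux_pt (W : ℕ) (hW : 1 ≤ W) (a b c K r s : ℝ) (hr : 0 < r) (hs : 0 < s)
    (hsW : s ^ 2 * W = 1) (ha : 0 < a)
    (h1 : a * r ^ 4 ≤ K) (h2 : |b| * r ^ 2 ≤ K) (h3 : |c| * r ≤ K) :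
    sDensity W a b c r ≤ Real.exp (7500 * K) * (Real.exp s * sDensity W a b c (Real.exp s * r)) ∨
    sDensity W a b c r ≤
      Real.exp (7500 * K) * (Real.exp (-s) * sDensity W a b c (Real.exp (-s) * r)) := by
  have hW1 : (1 : ℝ) ≤ W := by exact_mod_cast hW
  have hK : 0 < K := lt_of_lt_of_le (by positivity) h1
  by_contra hcon
  push Not at hcon
  obtain ⟨c1, c2⟩ := hcon
  have c1' := mul_lt_mul_of_pos_left c1 hr
  have c2' := mul_lt_mul_of_pos_left c2 hr
  have e1 : r * (Real.exp (7500 * K) * (Real.exp s * sDensity W a b c (Real.exp s * r)))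
    = Real.exp (7500 * K) * ((Real.exp s * r) * sDensity W a b c (Real.exp s * r)) := by ring
  have e2 : r * (Real.exp (7500 * K) * (Real.exp (-s) * sDensity W a b c (Real.exp (-s) * r)))
    = Real.exp (7500 * K) * ((Real.exp (-s) * r) * sDensity W a b c (Real.exp (-s) * r)) := by ring
  rw [e1, aux_rsD W hW, aux_rsD W hW] at c1'
  rw [e2, aux_rsD W hW, aux_rsD W hW] at c2'
  have hmul := mul_lt_mul'' c1' c2' (by positivity) (by positivity)
  have hxy : Real.exp s * Real.exp (-s) = 1 := by rw [← Real.exp_add]; simp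
  have hu := aux_u s hs (by nlinarith)
  set x := Real.exp s with hx
  set y := Real.exp (-s) with hy
  have hx0 : 0 < x := Real.exp_pos _
  have hy0 : 0 < y := Real.exp_pos _
  set P := a * r ^ 4 + b * r ^ 2 + c * r with hP
  set P1 := a * (x * r) ^ 4 + b * (x * r) ^ 2 + c * (x * r) with hP1
  set P2 := a * (y * r) ^ 4 + b * (y * r) ^ 2 + c * (y * r) with hP2
  have e3 : Real.exp (7500 * K) * ((x * r) ^ W * Real.exp (-(W : ℝ) * P1)) *
      (Real.exp (7500 * K) * ((y * r) ^ W * Real.exp (-(W : ℝ) * P2)))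
      = (r ^ W) ^ 2 * Real.exp (7500 * K + 7500 * K + -(W : ℝ) * P1 + -(W : ℝ) * P2) := by
    rw [Real.exp_add, Real.exp_add, Real.exp_add, mul_pow, mul_pow]
    have : x ^ W * y ^ W = 1 := by rw [← mul_pow, hxy, one_pow]
    linear_combination (Real.exp (7500 * K) * Real.exp (7500 * K) * (r ^ W) ^ 2 *
      Real.exp (-(W : ℝ) * P1) * Real.exp (-(W : ℝ) * P2)) * this
  have e4 : r ^ W * Real.exp (-(W : ℝ) * P) * (r ^ W * Real.exp (-(W : ℝ) * P))
      = (r ^ W) ^ 2 * Real.exp (-(W : ℝ) * P + -(W : ℝ) * P) := by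
    rw [Real.exp_add]; ring
  rw [e3, e4, mul_lt_mul_iff_right₀ (by positivity), Real.exp_lt_exp] at hmul
  -- now the exponent estimate
  set u := x + y - 2 with hu'
  have hu0 : 0 ≤ u := by
    have q : 2 ^ 2 ≤ (x + y) ^ 2 := by
      have := sq_nonneg (x - y)
      linarith [show (x + y) ^ 2 = (x - y) ^ 2 + 4 * (x * y) by ring]
    have := (pow_le_pow_iff_left₀ (by norm_num) (by positivity) (by norm_num)).mp q
    linarith
  have hs2 : s ^ 2 ≤ 1 := by
    have := mul_le_mul_of_nonneg_left hW1 (sq_nonneg s)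
    linarith
  have hu9 : u ≤ 9 := by linarith
  set v := x ^ 2 + y ^ 2 - 2 with hv'
  have hv : v = u * (u + 4) := by
    rw [hv', hu']; linear_combination (-2) * hxy
  have hv0 : 0 ≤ v := by rw [hv]; positivity
  have hv13 : v ≤ 13 * u := by
    have q2 : u * (u + 4) ≤ u * 13 := mul_le_mul_of_nonneg_left (by linarith) hu0
    linarith
  set w := x ^ 4 + y ^ 4 - 2 with hw'
  have hw : w = v * (v + 4) := by
    rw [hw', hv']; linear_combination (-2 * (x * y + 1)) * hxy
  have hw0 : 0 ≤ w := by rw [hw]; positivity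
  have hw13 : w ≤ 1573 * u := by
    have q1 : v + 4 ≤ 121 := by linarith
    have q2 : v * (v + 4) ≤ v * 121 := mul_le_mul_of_nonneg_left q1 hv0
    linarith
  have hPP : P1 + P2 - 2 * P = a * r ^ 4 * w + b * r ^ 2 * v + c * r * u := by
    rw [hP1, hP2, hP, hw', hv', hu']; ring
  have t1 : a * r ^ 4 * w ≤ K * (1573 * u) := by gcongr
  have t2 : b * r ^ 2 * v ≤ K * (13 * u) := by
    have : b * r ^ 2 ≤ K := le_trans (by gcongr; exact le_abs_self b) h2
    calc _ ≤ K * v := by gcongr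
      _ ≤ _ := by gcongr
  have t3 : c * r * u ≤ K * u := by
    have : c * r ≤ K := le_trans (by gcongr; exact le_abs_self c) h3
    gcongr
  have t4 : P1 + P2 - 2 * P ≤ K * (1587 * (9 * s ^ 2)) := by
    rw [hPP]
    calc _ ≤ K * (1587 * u) := by linarith
      _ ≤ _ := by gcongr
  have t5 : W * (P1 + P2 - 2 * P) ≤ W * (K * (1587 * (9 * s ^ 2))) := by gcongr
  have t6 : W * (K * (1587 * (9 * s ^ 2))) = 14283 * K := by
    linear_combination (14283 * K) * hsW
  linarith

lemma aux_var (W : ℕ) (hW : 3 ≤ W) (a b c K : ℝ) (ha : 0 < a) (B : Set ℝ) (hB : MeasurableSet B)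
    (hBm : sMeasure W a b c B ≤ ENNReal.ofReal (1 / 4))
    (hgood : ∀ r : ℝ, 0 < r → r ∉ B → a * r ^ 4 ≤ K ∧ |b| * r ^ 2 ≤ K ∧ |c| * r ≤ K) :
    1 / (8 * (2 * Real.exp (7500 * K) + 1)) / W ≤ variance Real.log (sMeasure W a b c) := by
  have hprob := aux_prob W (by omega) a b c ha
  have hmem := aux_memLp W hW a b c ha
  have hW0 : (0 : ℝ) < W := by exact_mod_cast (by omega : 0 < W)
  set μ := sMeasure W a b c with hμ
  set s : ℝ := (Real.sqrt W)⁻¹ with hs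
  have hs0 : 0 < s := by positivity
  have hsW : s ^ 2 * W = 1 := by
    rw [hs, inv_pow, Real.sq_sqrt hW0.le]; field_simp
  set m := ∫ r, Real.log r ∂μ with hm
  set V := variance Real.log μ with hV
  have hV0 : 0 ≤ V := variance_nonneg _ _
  have hcheb := meas_ge_le_variance_div_sq hmem (c := s / 2) (by positivity)
  set far : Set ℝ := {r | s / 2 ≤ |Real.log r - m|} with hfar
  have hfarm : μ far ≤ ENNReal.ofReal (4 * V * W) := by
    refine hcheb.trans (le_of_eq ?_)
    congr 1
    rw [← hV]
    field_simp
    linear_combination (-4 * V) * hsW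
  have hfarM : MeasurableSet far := by
    apply measurableSet_le measurable_const
    have := Real.measurable_log
    fun_prop
  set Q := Real.exp (7500 * K) with hQ
  have hQ0 : 0 < Q := Real.exp_pos _
  have hcont := aux_sD_cont W a b c
  set S : ℝ → Set ℝ := fun t => ((Set.Ioi 0 \ B) \ far) ∩
    {r | sDensity W a b c r ≤ Q * (Real.exp t * sDensity W a b c (Real.exp t * r))} with hS
  have hSM : ∀ t, MeasurableSet (S t) := by
    intro t
    refine ((measurableSet_Ioi.diff hB).diff hfarM).inter ?_
    apply measurableSet_le hcont.measurable
    fun_prop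
  have hSm : ∀ t, |t| = s → μ (S t) ≤ ENNReal.ofReal (Q * (4 * V * W)) := by
    intro t ht
    refine (aux_scale W a b c (S t) (hSM t) (fun r hr => hr.1.1.1) (Real.exp t) Q
      (Real.exp_pos _) hQ0.le (fun r hr => hr.2)).trans ?_
    rw [ENNReal.ofReal_mul hQ0.le]
    gcongr
    refine (measure_mono ?_).trans hfarm
    rintro _ ⟨r, hr, rfl⟩
    have hr0 : 0 < r := hr.1.1.1
    have hnf : ¬ (s / 2 ≤ |Real.log r - m|) := hr.1.2
    show s / 2 ≤ |Real.log (Real.exp t * r) - m|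
    rw [Real.log_mul (Real.exp_pos _).ne' hr0.ne', Real.log_exp]
    push Not at hnf
    have h3 : |t| ≤ |t + Real.log r - m| + |Real.log r - m| := by
      have := abs_sub (t + Real.log r - m) (Real.log r - m)
      rwa [show t + Real.log r - m - (Real.log r - m) = t by ring] at this
    linarith
  have hcover : Set.Ioi (0 : ℝ) ⊆ B ∪ far ∪ (S s ∪ S (-s)) := by
    intro r hr
    by_cases h1 : r ∈ B
    · exact Or.inl (Or.inl h1)
    by_cases h2 : r ∈ far
    · exact Or.inl (Or.inr h2)
    right
    obtain ⟨g1, g2, g3⟩ := hgood r hr h1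
    rcases aux_pt W (by omega) a b c K r s hr hs0 hsW ha g1 g2 g3 with h | h
    · exact Or.inl ⟨⟨⟨hr, h1⟩, h2⟩, h⟩
    · exact Or.inr ⟨⟨⟨hr, h1⟩, h2⟩, h⟩
  have hone : μ (Set.Ioi 0) = 1 := by
    rw [prob_compl_eq_zero_iff measurableSet_Ioi |>.symm]
    exact aux_ae W a b c
  have htot : (1 : ENNReal) ≤ ENNReal.ofReal (1 / 4 + 4 * V * W +
      (Q * (4 * V * W) + Q * (4 * V * W))) := by
    rw [← hone, ENNReal.ofReal_add (by positivity) (by positivity),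
      ENNReal.ofReal_add (by positivity) (by positivity),
      ENNReal.ofReal_add (by positivity) (by positivity)]
    refine (measure_mono hcover).trans ?_
    refine (measure_union_le _ _).trans ?_
    refine add_le_add ((measure_union_le _ _).trans (add_le_add hBm hfarm))
      ((measure_union_le _ _).trans (add_le_add (hSm s (abs_of_pos hs0)) (hSm (-s) ?_)))
    rw [abs_neg, abs_of_pos hs0]
  rw [ENNReal.one_le_ofReal] at htot
  rw [div_div, div_le_iff₀ (by positivity)]
  nlinarith

/-- Log-variance and lower bound of the spherical radius against the special
super-exponential densities: under the crude bound (I), the essential support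
bound (II) and the dichotomy (III), one has `Var(log r) ≥ c/W`, and off a set of
probability at most `C e^{-cW}` one has `r ≥ c₁ W^{-d}`. -/
theorem statement14 (A D Abar Cbar c₀ C₀ : ℝ)
    (hA : 0 < A) (hD : 1 ≤ D) (hAbar : 0 < Abar) (hCbar : 0 < Cbar)
    (hc₀ : 0 < c₀) (hC₀ : 0 < C₀) :
    ∃ (c c₁ C d : ℝ) (W₀ : ℕ), 0 < c ∧ 0 < c₁ ∧ 0 < C ∧ 0 < d ∧
      ∀ (W : ℕ), W₀ ≤ W → ∀ a2 b cc : ℝ, 0 < a2 →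
        -- (I) crude upper bound
        max (max a2 |b|) |cc| ≤ 2 * A ^ 2 * (W : ℝ) ^ (2 * D) →
        -- (II) essential support size
        sMeasure W a2 b cc (Set.Ici A)
          ≤ ENNReal.ofReal (C₀ * Real.exp (-c₀ * A ^ 2 * W)) →
        -- (III) dichotomy
        (max (max a2 |b|) |cc| ≤ Abar ∨
          ((∃ Br : Set ℝ, MeasurableSet Br ∧
              sMeasure W a2 b cc Br ≤ ENNReal.ofReal (C₀ * Real.exp (-c₀ * A ^ 2 * W)) ∧
              ∀ r : ℝ, 0 < r → r ∉ Br →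
                max (max (a2 * r ^ 4) (b * r ^ 2)) (|cc| * r) ≤ Abar) ∧
            (0 < b ∨ |b| < Cbar⁻¹ * Real.sqrt a2))) →
        (c / W ≤ variance Real.log (sMeasure W a2 b cc) ∧
          ∃ Bphi : Set ℝ, MeasurableSet Bphi ∧
            sMeasure W a2 b cc Bphi ≤ ENNReal.ofReal (C * Real.exp (-c * W)) ∧
            ∀ r ∈ Set.Ioi (0 : ℝ) \ Bphi, c₁ * (W : ℝ) ^ (-d) ≤ r) := by
  set K : ℝ := Abar * (1 + A) ^ 4 + Cbar⁻¹ * Real.sqrt Abar with hK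
  have hKs : 0 ≤ Cbar⁻¹ * Real.sqrt Abar := by positivity
  have hA4 : 1 ≤ (1 + A) ^ 4 := one_le_pow₀ (by linarith)
  have hKA : Abar * (1 + A) ^ 4 ≤ K := by linarith
  have hKA1 : Abar ≤ K := le_trans (by nlinarith) hKA
  have hlim : Filter.Tendsto (fun W : ℕ => C₀ * Real.exp (-c₀ * A ^ 2 * W)) Filter.atTop
      (nhds 0) := by
    rw [← mul_zero C₀]
    apply Filter.Tendsto.const_mul
    apply Real.tendsto_exp_atBot.comp
    apply Filter.Tendsto.const_mul_atTop_of_neg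
    · have : 0 < c₀ * A ^ 2 := by positivity
      linarith
    · exact tendsto_natCast_atTop_atTop
  obtain ⟨W₁, hW₁⟩ := Filter.eventually_atTop.mp
    (hlim.eventually (ge_mem_nhds (show (0 : ℝ) < 1 / 4 by norm_num)))
  have hQ := Real.exp_pos (7500 * K)
  refine ⟨1 / (8 * (2 * Real.exp (7500 * K) + 1)), Real.exp (-10) / (2 * A ^ 2 + 1), 1, 2 * D,
    max 3 W₁, by positivity, by positivity, by norm_num, by linarith, ?_⟩
  intro W hW a2 b cc ha hI hII hIII
  have hW3 : 3 ≤ W := (le_max_left _ _).trans hW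
  have hsmall := ENNReal.ofReal_le_ofReal (hW₁ W ((le_max_right _ _).trans hW))
  have hWr : (1 : ℝ) ≤ W := by exact_mod_cast (by omega : 1 ≤ W)
  constructor
  · rcases hIII with h | ⟨⟨Br, hBr, hBm, hBg⟩, hb⟩
    · refine aux_var W hW3 a2 b cc K ha (Set.Ici A) measurableSet_Ici (hII.trans hsmall) ?_
      intro r hr hrA
      have hrA : r < A := by simpa using hrA
      simp only [max_le_iff] at h
      obtain ⟨⟨g1, g2⟩, g3⟩ := h
      have hr1 : r ≤ 1 + A := by linarith
      have p1 : (1 + A) ≤ (1 + A) ^ 4 := le_self_pow₀ (by linarith) (by norm_num)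
      have p2 : (1 + A) ^ 2 ≤ (1 + A) ^ 4 := pow_le_pow_right₀ (by linarith) (by norm_num)
      refine ⟨le_trans ?_ hKA, le_trans ?_ hKA, le_trans ?_ hKA⟩
      · gcongr
      · exact le_trans (by gcongr) (mul_le_mul_of_nonneg_left p2 hAbar.le)
      · exact le_trans (by gcongr) (mul_le_mul_of_nonneg_left p1 hAbar.le)
    · refine aux_var W hW3 a2 b cc K ha Br hBr (hBm.trans hsmall) ?_
      intro r hr hrB
      have h := hBg r hr hrB
      simp only [max_le_iff] at h
      obtain ⟨⟨g1, g2⟩, g3⟩ := h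
      refine ⟨g1.trans hKA1, ?_, g3.trans hKA1⟩
      rcases hb with hb | hb
      · rw [abs_of_pos hb]; exact g2.trans hKA1
      · have e : Real.sqrt a2 * r ^ 2 = Real.sqrt (a2 * r ^ 4) := by
          rw [Real.sqrt_mul ha.le, show r ^ 4 = (r ^ 2) ^ 2 by ring,
            Real.sqrt_sq (by positivity)]
        calc |b| * r ^ 2 ≤ Cbar⁻¹ * Real.sqrt a2 * r ^ 2 := by gcongr
          _ = Cbar⁻¹ * Real.sqrt (a2 * r ^ 4) := by rw [mul_assoc, e]
          _ ≤ Cbar⁻¹ * Real.sqrt Abar := by gcongr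
          _ ≤ K := by
            have : 0 ≤ Abar * (1 + A) ^ 4 := by positivity
            linarith
  · simp only [max_le_iff] at hI
    obtain ⟨⟨g1, g2⟩, g3⟩ := hI
    have hWD : 1 ≤ (W : ℝ) ^ (2 * D) := Real.one_le_rpow hWr (by linarith)
    set X := (W : ℝ) ^ (2 * D) with hX
    have hMle : 2 * A ^ 2 * X ≤ (2 * A ^ 2 + 1) * X := by nlinarith
    have hM1 : 1 ≤ (2 * A ^ 2 + 1) * X := by nlinarith [sq_nonneg A]
    refine ⟨Set.Ioo 0 (Real.exp (-10) / ((2 * A ^ 2 + 1) * X)), measurableSet_Ioo, ?_, ?_⟩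
    · refine (aux_small W (by omega) a2 b cc _ hM1 ha (g1.trans hMle) (g2.trans hMle)
        (g3.trans hMle)).trans ?_
      apply ENNReal.ofReal_le_ofReal
      rw [one_mul]
      apply Real.exp_le_exp.mpr
      have : 1 / (8 * (2 * Real.exp (7500 * K) + 1)) ≤ 1 := by
        rw [div_le_one (by positivity)]; linarith
      nlinarith
    · rintro r ⟨hr, hrn⟩
      have hr : 0 < r := hr
      have h : Real.exp (-10) / ((2 * A ^ 2 + 1) * X) ≤ r := by
        by_contra hlt
        exact hrn ⟨hr, not_le.mp hlt⟩
      rw [Real.rpow_neg (by positivity), ← hX, ← div_eq_mul_inv, div_div]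
      exact h
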